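/- For every field 𝕜 of characteristic 0 and all integers n ≥ 1 and N ≥ 0, the complex D(n,N) has homology isomorphic to 𝕜 in degree 0 and zero homology in every degree p ≥ 1. -/

import Mathlib

open Classical

namespace Paper

/-- Merge the adjacent entries `j` and `j+1` of a list. -/
def mergeAdj (j : ℕ) (f : List ℕ) : List ℕ :=
  f.take j ++ (f.getD j 0 + f.getD (j + 1) 0) :: f.drop (j + 2)

/-- Basis of the degree-`p` component of `D(n,N)`: tuples
`(M₀; B₁; M₁; …; B_n; M_n)` with the `M_j ≥ 0`, the entries of each block `B_j`
positive, `Σ_j |B_j| = p` and `Σ_j M_j + Σ_{j,i} a_{j,i} = N`. -/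
def DBasis (n N p : ℕ) : Type :=
  {x : (Fin (n + 1) → ℕ) × (Fin n → List ℕ) //
    (∀ j, ∀ a ∈ x.2 j, 1 ≤ a) ∧ (∑ j, (x.2 j).length) = p ∧
    ((∑ j, x.1 j) + ∑ j, (x.2 j).sum) = N}

/-- The `i`-th bar-type face of the `j`-th block: merge adjacent entries of the
list `[M_{j−1}] ++ B_j ++ [M_j]` at position `i`, updating `M_{j−1}`, `B_j`, `M_j`. -/
def dFace {n : ℕ} (x : (Fin (n + 1) → ℕ) × (Fin n → List ℕ)) (j : Fin n) (i : ℕ) :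
    (Fin (n + 1) → ℕ) × (Fin n → List ℕ) :=
  let full := x.1 j.castSucc :: (x.2 j ++ [x.1 j.succ])
  let merged := mergeAdj i full
  (Function.update (Function.update x.1 j.castSucc merged.headI) j.succ
      (merged.getLastD 0),
    Function.update x.2 j merged.tail.dropLast)

noncomputable def deltaD (𝕜 : Type) [Field 𝕜] (n N p : ℕ)
    (x : (Fin (n + 1) → ℕ) × (Fin n → List ℕ)) : DBasis n N p →₀ 𝕜 :=
  if h : (∀ j, ∀ a ∈ x.2 j, 1 ≤ a) ∧ (∑ j, (x.2 j).length) = p ∧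
      ((∑ j, x.1 j) + ∑ j, (x.2 j).sum) = N
  then Finsupp.single ⟨x, h⟩ 1 else 0

/-- The differential of `D(n,N)`: `d = Σ_j (−1)^{p₁+⋯+p_{j−1}} d_j`, where `d_j`
(nontrivial only when `B_j ≠ ∅`) is the alternating sum of the bar-type merges of
the `j`-th block. -/
noncomputable def diffD (𝕜 : Type) [Field 𝕜] (n N p : ℕ) :
    (DBasis n N (p + 1) →₀ 𝕜) →ₗ[𝕜] (DBasis n N p →₀ 𝕜) :=
  Finsupp.lift _ 𝕜 _ fun x =>
    ∑ j : Fin n,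
      if (x.val.2 j).length = 0 then 0 else
        ∑ i ∈ Finset.range ((x.val.2 j).length + 1),
          ((-1 : 𝕜) ^ ((∑ j' ∈ Finset.univ.filter (fun j' => j' < j),
              (x.val.2 j').length) + i)) •
            deltaD 𝕜 n N p (dFace x.val j i)

/-- Tuples `(M₀; B₁; M₁; …; B_n; M_n)` without constraints on entries, degree or weight. -/
abbrev St (n : ℕ) : Type := (Fin (n + 1) → ℕ) × (Fin n → List ℕ)

namespace St

/-- Prepend `M; B` to a tuple. -/
def cons {n : ℕ} (M : ℕ) (B : List ℕ) (y : St n) : St (n + 1) :=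
  (Fin.cons M y.1, Fin.cons B y.2)

/-- Remove `M₀; B₁` from a tuple. -/
def tl {n : ℕ} (x : St (n + 1)) : St n := (Fin.tail x.1, Fin.tail x.2)

/-- Replace `M₀` by `m`. -/
def setHead {n : ℕ} (m : ℕ) (y : St n) : St n := (Fin.cons m (Fin.tail y.1), y.2)

/-- Add `m` to `M₀`. -/
def addHead {n : ℕ} (m : ℕ) (y : St n) : St n := setHead (m + y.1 0) y

/-- All entries of the blocks are positive. -/
def Pos {n : ℕ} (x : St n) : Prop := ∀ j, ∀ a ∈ x.2 j, 1 ≤ a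

/-- The total length of the blocks. -/
def deg {n : ℕ} (x : St n) : ℕ := ∑ j, (x.2 j).length

/-- The sum of all entries. -/
def wt {n : ℕ} (x : St n) : ℕ := (∑ j, x.1 j) + ∑ j, (x.2 j).sum

/-- Prepend to `y` the list `L = [M] ++ B ++ [m]`, whose last entry overwrites `M₀`. -/
def glue {n : ℕ} (y : St n) (L : List ℕ) : St (n + 1) :=
  cons L.headI L.tail.dropLast (setHead (L.getLastD 0) y)

variable {n : ℕ} (M m k : ℕ) (B : List ℕ) (y : St n)

@[simp] lemma cons_fst_zero : (cons M B y).1 0 = M := rfl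
@[simp] lemma cons_snd_zero : (cons M B y).2 0 = B := rfl
@[simp] lemma tl_cons : (cons M B y).tl = y := rfl

lemma cons_eta (x : St (n + 1)) : cons (x.1 0) (x.2 0) x.tl = x :=
  Prod.ext (Fin.cons_self_tail _) (Fin.cons_self_tail _)

lemma exists_cons (x : St (n + 1)) : ∃ M B y, x = cons M B y := ⟨_, _, _, (cons_eta x).symm⟩

@[simp] lemma setHead_fst_zero : (setHead m y).1 0 = m := rfl
lemma setHead_self : setHead (y.1 0) y = y := Prod.ext (Fin.cons_self_tail _) rfl
@[simp] lemma addHead_zero : addHead 0 y = y := by simp [addHead, setHead_self]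
@[simp] lemma addHead_cons : addHead m (cons M B y) = cons (m + M) B y := rfl
lemma addHead_setHead : addHead m (setHead k y) = setHead (m + k) y := rfl

lemma glue_eq : glue y (M :: (B ++ [m])) = cons M B (setHead m y) := by
  have h : (M :: (B ++ [m])).getLastD 0 = m := by
    rw [← List.cons_append, List.getLastD_eq_getLast?, List.getLast?_concat, Option.getD_some]
  rw [glue, h]
  simp

lemma pos_cons : (cons M B y).Pos ↔ (∀ a ∈ B, 1 ≤ a) ∧ y.Pos := by
  simp [Pos, cons, Fin.forall_fin_succ]

lemma deg_cons : (cons M B y).deg = B.length + y.deg := by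
  simp [deg, cons, Fin.sum_univ_succ]

lemma wt_cons : (cons M B y).wt = M + B.sum + y.wt := by
  simp [wt, cons, Fin.sum_univ_succ]; ring

lemma pos_setHead : (setHead m y).Pos ↔ y.Pos := Iff.rfl
lemma deg_setHead : (setHead m y).deg = y.deg := rfl

lemma wt_setHead : (setHead m y).wt + y.1 0 = m + y.wt := by
  simp [wt, setHead, Fin.sum_univ_succ, Fin.tail]; ring

lemma pos_addHead : (addHead m y).Pos ↔ y.Pos := Iff.rfl
lemma deg_addHead : (addHead m y).deg = y.deg := rfl

lemma wt_addHead : (addHead m y).wt = m + y.wt := by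
  have := wt_setHead (m + y.1 0) y
  simp only [addHead]; omega

end St

open St

lemma mergeAdj_zero (a b : ℕ) (L : List ℕ) : mergeAdj 0 (a :: b :: L) = (a + b) :: L := by
  simp [mergeAdj]

lemma mergeAdj_succ (a i : ℕ) (L : List ℕ) :
    mergeAdj (i + 1) (a :: L) = a :: mergeAdj i L := by
  simp [mergeAdj]

/-- A bar-type merge preserves positivity of the inner entries and the sum of all entries. -/
lemma exists_mergeAdj_eq (B : List ℕ) (m : ℕ) (hB : B ≠ []) :
    ∀ (M i : ℕ), (∀ a ∈ B, 1 ≤ a) → i ≤ B.length →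
    ∃ M' B' m', mergeAdj i (M :: (B ++ [m])) = M' :: (B' ++ [m']) ∧
      (∀ a ∈ B', 1 ≤ a) ∧ B'.length + 1 = B.length ∧
      M' + B'.sum + m' = M + B.sum + m ∧ M ≤ M' := by
  induction B with
  | nil => exact absurd rfl hB
  | cons a B ih =>
    intro M i hpos hi
    rcases i with _ | i
    · refine ⟨M + a, B, m, by simp [mergeAdj_zero], fun b hb => hpos b (by simp [hb]), by simp,
        by simp; ring, by omega⟩
    · rcases B with _ | ⟨b, B⟩
      · obtain rfl : i = 0 := by simpa using hi
        exact ⟨M, [], a + m, by simp [mergeAdj_succ, mergeAdj_zero], by simp, by simp,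
          by simp; ring, le_rfl⟩
      · obtain ⟨M', B', m', h1, h2, h3, h4, h5⟩ := ih (by simp) a i
          (fun c hc => hpos c (List.mem_cons_of_mem _ hc)) (by simpa using hi)
        refine ⟨M, M' :: B', m', ?_, ?_, by simp at h3 ⊢; omega, by simp at h4 ⊢; omega, le_rfl⟩
        · rw [List.cons_append, mergeAdj_succ, h1]; simp
        · have := hpos a (by simp)
          intro c hc
          rcases List.mem_cons.1 hc with rfl | hc
          · omega
          · exact h2 c hc

lemma dFace_zero {n : ℕ} (M : ℕ) (B : List ℕ) (y : St n) (i : ℕ) :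
    dFace (cons M B y) 0 i = glue y (mergeAdj i (M :: (B ++ [y.1 0]))) := by
  refine Prod.ext ?_ ?_
  · funext j
    refine Fin.cases ?_ (fun j => ?_) j
    · simp [dFace, glue, St.cons]
    · refine Fin.cases ?_ (fun j => ?_) j
      · simp [dFace, glue, St.cons, setHead]
      · have h1 : (j.succ.succ : Fin (n + 2)) ≠ 1 := by simp [Fin.ext_iff]
        simp [dFace, glue, St.cons, setHead, Fin.tail, h1]
  · funext j
    refine Fin.cases ?_ (fun j => ?_) j
    · simp [dFace, glue, St.cons]
    · simp [dFace, glue, St.cons, setHead]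

lemma dFace_succ {n : ℕ} (M : ℕ) (B : List ℕ) (y : St n) (j : Fin n) (i : ℕ) :
    dFace (cons M B y) j.succ i = cons M B (dFace y j i) := by
  simp only [dFace, St.cons, Fin.castSucc_succ, Fin.cons_succ, Fin.cons_update]

section Chains

variable (𝕜 : Type) [Field 𝕜] {n : ℕ}

/-- The differential of a tuple. -/
noncomputable def bd (x : St n) : St n →₀ 𝕜 :=
  ∑ j : Fin n,
    if (x.2 j).length = 0 then 0 else
      ∑ i ∈ Finset.range ((x.2 j).length + 1),
        ((-1 : 𝕜) ^ ((∑ j' ∈ Finset.univ.filter (fun j' => j' < j),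
            (x.2 j').length) + i)) •
          Finsupp.single (dFace x j i) 1

/-- The differential on the span of all tuples. -/
noncomputable def bdL : (St n →₀ 𝕜) →ₗ[𝕜] (St n →₀ 𝕜) := Finsupp.linearCombination 𝕜 (bd 𝕜)

/-- Linear extension of `cons`. -/
noncomputable def consL (M : ℕ) (B : List ℕ) : (St n →₀ 𝕜) →ₗ[𝕜] (St (n + 1) →₀ 𝕜) :=
  Finsupp.lmapDomain 𝕜 𝕜 (cons M B)

/-- Linear extension of `addHead`. -/
noncomputable def addHeadL (m : ℕ) : (St n →₀ 𝕜) →ₗ[𝕜] (St n →₀ 𝕜) :=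
  Finsupp.lmapDomain 𝕜 𝕜 (addHead m)

/-- The contribution of the first block to the differential. -/
noncomputable def bdHead (M : ℕ) (B : List ℕ) (y : St n) : St (n + 1) →₀ 𝕜 :=
  if B = [] then 0 else ∑ i ∈ Finset.range (B.length + 1),
    (-1 : 𝕜) ^ i • Finsupp.single (glue y (mergeAdj i (M :: (B ++ [y.1 0])))) 1

/-- The homotopy `(M₀; B₁; …) ↦ (0; M₀ :: B₁; …)` contracting the first block. -/
noncomputable def sL : (St (n + 1) →₀ 𝕜) →ₗ[𝕜] (St (n + 1) →₀ 𝕜) :=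
  Finsupp.linearCombination 𝕜 fun x =>
    if x.1 0 = 0 then 0 else Finsupp.single (cons 0 (x.1 0 :: x.2 0) x.tl) 1

/-- The projection collapsing the first block. -/
noncomputable def piL : (St (n + 1) →₀ 𝕜) →ₗ[𝕜] (St n →₀ 𝕜) :=
  Finsupp.linearCombination 𝕜 fun x =>
    if x.2 0 = [] then Finsupp.single (addHead (x.1 0) x.tl) 1 else 0

/-- The contracting homotopy of all blocks. -/
noncomputable def hL : (n : ℕ) → (St n →₀ 𝕜) →ₗ[𝕜] (St n →₀ 𝕜)
  | 0 => 0
  | n + 1 => sL 𝕜 + consL 𝕜 0 [] ∘ₗ hL n ∘ₗ piL 𝕜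

/-- The projection collapsing all blocks. -/
noncomputable def pL : (n : ℕ) → (St n →₀ 𝕜) →ₗ[𝕜] (St n →₀ 𝕜)
  | 0 => LinearMap.id
  | n + 1 => consL 𝕜 0 [] ∘ₗ pL n ∘ₗ piL 𝕜

/-- The tuple `(0; ∅; 0; …; ∅; N)`. -/
def base (N : ℕ) : (n : ℕ) → St n
  | 0 => (fun _ => N, Fin.elim0)
  | n + 1 => cons 0 [] (base N n)

@[simp] lemma bdL_single (x : St n) : bdL 𝕜 (Finsupp.single x 1) = bd 𝕜 x := by
  simp [bdL]

@[simp] lemma consL_single (M : ℕ) (B : List ℕ) (y : St n) :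
    consL 𝕜 M B (Finsupp.single y 1) = Finsupp.single (cons M B y) 1 := by
  simp [consL]

@[simp] lemma addHeadL_single (m : ℕ) (y : St n) :
    addHeadL 𝕜 m (Finsupp.single y 1) = Finsupp.single (addHead m y) 1 := by
  simp [addHeadL]

lemma sL_single (M : ℕ) (B : List ℕ) (y : St n) :
    sL 𝕜 (Finsupp.single (cons M B y) 1) =
      if M = 0 then 0 else Finsupp.single (cons 0 (M :: B) y) 1 := by
  simp [sL]
  rfl

lemma piL_single (M : ℕ) (B : List ℕ) (y : St n) :
    piL 𝕜 (Finsupp.single (cons M B y) 1) =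
      if B = [] then Finsupp.single (addHead M y) 1 else 0 := by
  simp [piL]
  rfl

lemma bd_cons (M : ℕ) (B : List ℕ) (y : St n) :
    bd 𝕜 (cons M B y) =
      bdHead 𝕜 M B y + (-1 : 𝕜) ^ B.length • consL 𝕜 M B (bd 𝕜 y) := by
  unfold bd
  rw [Fin.sum_univ_succ]
  congr 1
  · simp only [bdHead, cons_snd_zero, dFace_zero, List.length_eq_zero_iff]
    simp
  · rw [map_sum, Finset.smul_sum]
    refine Finset.sum_congr rfl fun j _ => ?_
    have hs : ∑ j' ∈ Finset.univ.filter (fun j' => j' < j.succ), ((cons M B y).2 j').length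
        = B.length + ∑ j' ∈ Finset.univ.filter (fun j' => j' < j), (y.2 j').length := by
      simp [Finset.sum_filter, Fin.sum_univ_succ, St.cons]
    have hj : (cons M B y).2 j.succ = y.2 j := rfl
    rw [hs, hj]
    split_ifs with h
    · simp
    · simp only [map_sum, Finset.smul_sum, map_smul, consL_single, dFace_succ, smul_smul,
        ← pow_add, add_assoc]

lemma linearMap_ext_cons {V : Type} [AddCommGroup V] [Module 𝕜 V]
    {f g : (St (n + 1) →₀ 𝕜) →ₗ[𝕜] V}
    (h : ∀ M B y, f (Finsupp.single (cons M B y) 1) = g (Finsupp.single (cons M B y) 1)) :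
    f = g := by
  refine Finsupp.lhom_ext' fun x => LinearMap.ext_ring ?_
  obtain ⟨M, B, y, rfl⟩ := exists_cons x
  exact h M B y

lemma sL_consL (M : ℕ) (B : List ℕ) (v : St n →₀ 𝕜) :
    sL 𝕜 (consL 𝕜 M B v) = if M = 0 then 0 else consL 𝕜 0 (M :: B) v := by
  induction v using Finsupp.induction_linear with
  | zero => simp
  | add v w hv hw => simp only [map_add, hv, hw]; split_ifs <;> simp
  | single y c =>
    rw [← mul_one c, ← smul_eq_mul, ← Finsupp.smul_single]
    simp only [map_smul, consL_single, sL_single]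
    split_ifs <;> simp

lemma piL_consL (M : ℕ) (B : List ℕ) (v : St n →₀ 𝕜) :
    piL 𝕜 (consL 𝕜 M B v) = if B = [] then addHeadL 𝕜 M v else 0 := by
  induction v using Finsupp.induction_linear with
  | zero => simp
  | add v w hv hw => simp only [map_add, hv, hw]; split_ifs <;> simp
  | single y c =>
    rw [← mul_one c, ← smul_eq_mul, ← Finsupp.smul_single]
    simp only [map_smul, consL_single, piL_single]
    split_ifs <;> simp

lemma addHeadL_consL (m M : ℕ) (B : List ℕ) (v : St n →₀ 𝕜) :
    addHeadL 𝕜 m (consL 𝕜 M B v) = consL 𝕜 (m + M) B v := by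
  simp only [addHeadL, consL, Finsupp.lmapDomain_apply, ← Finsupp.mapDomain_comp]
  rfl

lemma glue_cons_mergeAdj_add (m M i : ℕ) (B : List ℕ) (hB : B ≠ []) (hi : i ≤ B.length)
    (k : ℕ) (y : St n) :
    glue y (mergeAdj i ((m + M) :: (B ++ [k]))) =
      addHead m (glue y (mergeAdj i (M :: (B ++ [k])))) := by
  rcases i with _ | i
  · obtain ⟨a, B, rfl⟩ := List.exists_cons_of_ne_nil hB
    simp only [List.cons_append, mergeAdj_zero, glue_eq, addHead_cons, add_assoc]
  · have hl : mergeAdj i (B ++ [k]) ≠ [] := by simp [mergeAdj]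
    simp only [mergeAdj_succ]
    obtain ⟨L, c, hL⟩ := List.eq_nil_or_concat (mergeAdj i (B ++ [k])) |>.resolve_left hl
    rw [hL, List.concat_eq_append, glue_eq, glue_eq, addHead_cons]

lemma bd_addHead (m : ℕ) (y : St n) : bd 𝕜 (addHead m y) = addHeadL 𝕜 m (bd 𝕜 y) := by
  cases n with
  | zero => simp [bd]
  | succ n =>
    obtain ⟨M, B, y, rfl⟩ := exists_cons y
    rw [addHead_cons, bd_cons, bd_cons, map_add, map_smul, addHeadL_consL]
    congr 1
    unfold bdHead
    split_ifs with hB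
    · simp
    · rw [map_sum]
      refine Finset.sum_congr rfl fun i hi => ?_
      rw [map_smul, addHeadL_single, glue_cons_mergeAdj_add _ _ _ _ hB]
      exact Nat.lt_succ_iff.1 (Finset.mem_range.1 hi)

lemma exists_mergeAdj_length (B : List ℕ) (m : ℕ) (hB : B ≠ []) (M i : ℕ)
    (hi : i ≤ B.length) :
    ∃ M' B' m', mergeAdj i (M :: (B ++ [m])) = M' :: (B' ++ [m']) ∧
      B'.length + 1 = B.length := by
  have hlen : (mergeAdj i (M :: (B ++ [m]))).length = B.length + 1 := by
    simp [mergeAdj]; omega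
  obtain ⟨M', L, hL⟩ := List.exists_cons_of_ne_nil
    (List.ne_nil_of_length_eq_add_one hlen)
  have hB0 := List.length_pos_iff.2 hB
  rw [hL, List.length_cons] at hlen
  obtain ⟨B', m', h⟩ := (List.eq_nil_or_concat L).resolve_left
    (by rintro rfl; simp only [List.length_nil] at hlen; omega)
  rw [List.concat_eq_append] at h
  subst h
  exact ⟨M', B', m', hL, by simpa using hlen⟩

lemma piL_bdHead (M : ℕ) (B : List ℕ) (y : St n) : piL 𝕜 (bdHead 𝕜 M B y) = 0 := by
  unfold bdHead
  split_ifs with hB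
  · simp
  rcases B with _ | ⟨a, _ | ⟨b, B⟩⟩
  · simp at hB
  · have h1 := glue_eq (M + a) (y.1 0) [] y
    have h2 := glue_eq M (a + y.1 0) [] y
    simp only [List.nil_append] at h1 h2
    simp [Finset.sum_range_succ, mergeAdj_zero, mergeAdj_succ, h1, h2, piL_single,
      addHead_setHead, add_assoc]
  · rw [map_sum]
    refine Finset.sum_eq_zero fun i hi => ?_
    obtain ⟨M', B', m', h, hl⟩ := exists_mergeAdj_length (a :: b :: B) (y.1 0) hB M i
      (Nat.lt_succ_iff.1 (Finset.mem_range.1 hi))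
    have : B' ≠ [] := by rintro rfl; simp at hl
    rw [map_smul, h, glue_eq, piL_single, if_neg this, smul_zero]

lemma piL_bdL (v : St (n + 1) →₀ 𝕜) : piL 𝕜 (bdL 𝕜 v) = bdL 𝕜 (piL 𝕜 v) := by
  refine LinearMap.congr_fun (f := piL 𝕜 ∘ₗ bdL 𝕜) (g := bdL 𝕜 ∘ₗ piL 𝕜)
    (linearMap_ext_cons 𝕜 fun M B y => ?_) v
  simp only [LinearMap.comp_apply, bdL_single, bd_cons, map_add, map_smul, piL_bdHead, zero_add,
    piL_consL, piL_single]
  split_ifs with hB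
  · simp [hB, bd_addHead]
  · simp

lemma bdL_consL_nil (v : St n →₀ 𝕜) : bdL 𝕜 (consL 𝕜 0 [] v) = consL 𝕜 0 [] (bdL 𝕜 v) := by
  refine LinearMap.congr_fun (f := bdL 𝕜 ∘ₗ consL 𝕜 0 []) (g := consL 𝕜 0 [] ∘ₗ bdL 𝕜)
    (Finsupp.lhom_ext' fun y => LinearMap.ext_ring ?_) v
  simp [bd_cons, bdHead]

/-- The homotopy identity for the first block. -/
lemma bdHead_homotopy (M : ℕ) (B : List ℕ) (y : St n) (hB : ∀ a ∈ B, 1 ≤ a) :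
    (if M = 0 then 0 else bdHead 𝕜 0 (M :: B) y) + sL 𝕜 (bdHead 𝕜 M B y) =
      Finsupp.single (cons M B y) 1 -
        (if B = [] then Finsupp.single (cons 0 [] (addHead M y)) 1 else 0) := by
  have hglue (M : ℕ) (B : List ℕ) : glue y (M :: (B ++ [y.1 0])) = cons M B y := by
    rw [glue_eq, setHead_self]
  by_cases hB0 : B = []
  · subst hB0
    by_cases hM : M = 0
    · simp [hM, bdHead]
    · have h1 := hglue M []
      have h2 := glue_eq 0 (M + y.1 0) [] y
      simp only [List.nil_append] at h1 h2
      simp [hM, bdHead, Finset.sum_range_succ, mergeAdj_zero, mergeAdj_succ, h1, h2, addHead,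
        sub_eq_add_neg]
  have hs : ∀ i ≤ B.length, sL 𝕜 (Finsupp.single (glue y (mergeAdj i (M :: (B ++ [y.1 0])))) 1) =
      if (mergeAdj i (M :: (B ++ [y.1 0]))).headI = 0 then 0 else
        Finsupp.single (glue y (0 :: mergeAdj i (M :: (B ++ [y.1 0])))) 1 := by
    intro i hi
    obtain ⟨M', B', m', h, -⟩ := exists_mergeAdj_length B (y.1 0) hB0 M i hi
    rw [h, glue_eq, sL_single, ← List.cons_append, glue_eq]
    rfl
  have hsum : sL 𝕜 (bdHead 𝕜 M B y) = ∑ i ∈ Finset.range (B.length + 1), (-1 : 𝕜) ^ i •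
      (if (mergeAdj i (M :: (B ++ [y.1 0]))).headI = 0 then 0 else
        Finsupp.single (glue y (0 :: mergeAdj i (M :: (B ++ [y.1 0])))) 1) := by
    rw [bdHead, if_neg hB0, map_sum]
    refine Finset.sum_congr rfl fun i hi => ?_
    rw [map_smul, hs i (Nat.lt_succ_iff.1 (Finset.mem_range.1 hi))]
  obtain ⟨a, B, rfl⟩ := List.exists_cons_of_ne_nil hB0
  have ha : a ≠ 0 := Nat.one_le_iff_ne_zero.1 (hB a (by simp))
  rw [hsum, if_neg hB0, sub_zero]
  by_cases hM : M = 0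
  · subst hM
    rw [if_pos rfl, zero_add, Finset.sum_range_succ']
    have h0 : glue y (0 :: a :: (B ++ [y.1 0])) = cons 0 (a :: B) y := hglue 0 (a :: B)
    simp [mergeAdj_succ, mergeAdj_zero, ha, h0]
  · rw [if_neg hM, bdHead, if_neg (by simp), List.length_cons, Finset.sum_range_succ', add_right_comm,
      ← Finset.sum_add_distrib, Finset.sum_eq_zero, zero_add]
    · simp only [List.cons_append, mergeAdj_zero, zero_add, pow_zero, one_smul]
      rw [← List.cons_append, hglue]
    · intro i _
      have : (mergeAdj i (M :: (a :: B ++ [y.1 0]))).headI ≠ 0 := by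
        rcases i with _ | i
        · simp [mergeAdj_zero, ha]
        · simpa [mergeAdj_succ] using hM
      rw [if_neg this, List.cons_append, mergeAdj_succ, pow_succ]
      simp

lemma sL_homotopy (x : St (n + 1)) (hx : x.Pos) :
    bdL 𝕜 (sL 𝕜 (Finsupp.single x 1)) + sL 𝕜 (bd 𝕜 x) =
      Finsupp.single x 1 - consL 𝕜 0 [] (piL 𝕜 (Finsupp.single x 1)) := by
  obtain ⟨M, B, y, rfl⟩ := exists_cons x
  have h := bdHead_homotopy 𝕜 M B y ((pos_cons ..).1 hx).1
  rw [piL_single, apply_ite (consL 𝕜 0 []), consL_single, map_zero, ← h, bd_cons, map_add,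
    map_smul, sL_consL, sL_single]
  split_ifs with hM
  · simp
  · rw [bdL_single, bd_cons, List.length_cons, pow_succ]
    simp only [mul_neg, mul_one, neg_smul]
    abel

lemma hL_homotopy (x : St n) (hx : x.Pos) :
    bdL 𝕜 (hL 𝕜 n (Finsupp.single x 1)) + hL 𝕜 n (bd 𝕜 x) =
      Finsupp.single x 1 - pL 𝕜 n (Finsupp.single x 1) := by
  induction n with
  | zero => simp [hL, pL]
  | succ n ih =>
    have h := sL_homotopy 𝕜 x hx
    have hpi : bdL 𝕜 (hL 𝕜 n (piL 𝕜 (Finsupp.single x 1))) +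
        hL 𝕜 n (bdL 𝕜 (piL 𝕜 (Finsupp.single x 1))) =
        piL 𝕜 (Finsupp.single x 1) - pL 𝕜 n (piL 𝕜 (Finsupp.single x 1)) := by
      obtain ⟨M, B, y, rfl⟩ := exists_cons x
      rw [piL_single]
      split_ifs
      · rw [bdL_single, ih _ ((pos_addHead ..).2 ((pos_cons ..).1 hx).2)]
      · simp
    rw [← piL_bdL, bdL_single] at hpi
    have hpi' := congrArg (consL 𝕜 0 []) hpi
    simp only [hL, pL, LinearMap.add_apply, LinearMap.comp_apply, map_add, map_sub,
      bdL_consL_nil] at hpi' ⊢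
    rw [add_add_add_comm, h, hpi']
    abel

lemma pL_bdL (v : St n →₀ 𝕜) : pL 𝕜 n (bdL 𝕜 v) = 0 := by
  induction n with
  | zero =>
    refine LinearMap.congr_fun (f := pL 𝕜 0 ∘ₗ bdL 𝕜) (g := 0)
      (Finsupp.lhom_ext' fun y => LinearMap.ext_ring ?_) v
    simp [bd]
  | succ n ih => simp [pL, piL_bdL, ih]

/-- Chains supported on the tuples with positive block entries, degree `p` and weight `N`. -/
noncomputable def chains (n N p : ℕ) : Submodule 𝕜 (St n →₀ 𝕜) :=
  Finsupp.supported 𝕜 𝕜 {x | x.Pos ∧ x.deg = p ∧ x.wt = N}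

variable {𝕜} {N p : ℕ}

lemma single_mem_chains {x : St n} (h : x.Pos) (hd : x.deg = p) (hw : x.wt = N) (c : 𝕜) :
    Finsupp.single x c ∈ chains 𝕜 n N p :=
  Finsupp.single_mem_supported 𝕜 c ⟨h, hd, hw⟩

/-- A linear map sending admissible tuples into a submodule sends chains into it. -/
lemma map_mem_of_mem_chains {V : Type} [AddCommGroup V] [Module 𝕜 V]
    {f : (St n →₀ 𝕜) →ₗ[𝕜] V} {W : Submodule 𝕜 V}
    (h : ∀ x : St n, x.Pos → x.deg = p → x.wt = N → f (Finsupp.single x 1) ∈ W)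
    {v : St n →₀ 𝕜} (hv : v ∈ chains 𝕜 n N p) : f v ∈ W := by
  rw [chains, Finsupp.supported_eq_span_single] at hv
  refine Submodule.span_le (p := W.comap f).2 ?_ hv
  rintro _ ⟨x, ⟨h1, h2, h3⟩, rfl⟩
  exact h x h1 h2 h3

lemma consL_mem_chains {M : ℕ} {B : List ℕ} (hB : ∀ a ∈ B, 1 ≤ a) {q K : ℕ}
    (hq : B.length + q = p) (hK : M + B.sum + K = N) {v : St n →₀ 𝕜}
    (hv : v ∈ chains 𝕜 n K q) : consL 𝕜 M B v ∈ chains 𝕜 (n + 1) N p := by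
  refine map_mem_of_mem_chains (fun x h1 h2 h3 => ?_) hv
  rw [consL_single]
  exact single_mem_chains ((pos_cons ..).2 ⟨hB, h1⟩) (by rw [deg_cons, h2, hq])
    (by rw [wt_cons, h3, hK]) 1

lemma piL_mem_chains {v : St (n + 1) →₀ 𝕜} (hv : v ∈ chains 𝕜 (n + 1) N p) :
    piL 𝕜 v ∈ chains 𝕜 n N p := by
  refine map_mem_of_mem_chains (fun x h1 h2 h3 => ?_) hv
  obtain ⟨M, B, y, rfl⟩ := exists_cons x
  rw [piL_single]
  split_ifs with hB
  · subst hB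
    exact single_mem_chains ((pos_addHead ..).2 ((pos_cons ..).1 h1).2)
      (by simpa [deg_cons, deg_addHead] using h2) (by simpa [wt_cons, wt_addHead] using h3) 1
  · exact zero_mem _

lemma sL_mem_chains {v : St (n + 1) →₀ 𝕜} (hv : v ∈ chains 𝕜 (n + 1) N p) :
    sL 𝕜 v ∈ chains 𝕜 (n + 1) N (p + 1) := by
  refine map_mem_of_mem_chains (fun x h1 h2 h3 => ?_) hv
  obtain ⟨M, B, y, rfl⟩ := exists_cons x
  rw [sL_single]
  rw [pos_cons] at h1
  rw [deg_cons] at h2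
  rw [wt_cons] at h3
  split_ifs with hM
  · exact zero_mem _
  · refine single_mem_chains ((pos_cons ..).2 ⟨?_, h1.2⟩) ?_ ?_ 1
    · simpa using ⟨Nat.one_le_iff_ne_zero.2 hM, h1.1⟩
    · simp [deg_cons]; omega
    · simp [wt_cons]; omega

lemma hL_mem_chains {v : St n →₀ 𝕜} (hv : v ∈ chains 𝕜 n N p) :
    hL 𝕜 n v ∈ chains 𝕜 n N (p + 1) := by
  induction n with
  | zero => simp [hL]
  | succ n ih =>
    exact add_mem (sL_mem_chains hv) (consL_mem_chains (by simp) (by simp) (by simp)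
      (ih (piL_mem_chains hv)))

lemma pL_mem_span {v : St n →₀ 𝕜} (hv : v ∈ chains 𝕜 n N p) :
    pL 𝕜 n v ∈ Submodule.span 𝕜 {Finsupp.single (base N n) (1 : 𝕜)} := by
  induction n with
  | zero =>
    refine map_mem_of_mem_chains (fun x h1 h2 h3 => ?_) hv
    have : x = base N 0 := by
      refine Prod.ext (funext fun j => ?_) (Subsingleton.elim _ _)
      obtain rfl : j = 0 := Fin.fin_one_eq_zero j
      simpa [wt, base] using h3
    rw [this]
    exact Submodule.mem_span_singleton_self _
  | succ n ih =>
    obtain ⟨c, hc⟩ := Submodule.mem_span_singleton.1 (ih (piL_mem_chains hv))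
    refine Submodule.mem_span_singleton.2 ⟨c, ?_⟩
    rw [pL, LinearMap.comp_apply, LinearMap.comp_apply, ← hc, map_smul, consL_single, base]

lemma pL_eq_zero {v : St n →₀ 𝕜} (hv : v ∈ chains 𝕜 n N (p + 1)) : pL 𝕜 n v = 0 := by
  induction n with
  | zero =>
    refine (Submodule.mem_bot 𝕜).1 (map_mem_of_mem_chains (fun x _ h2 _ => ?_) hv)
    simp [deg] at h2
  | succ n ih => simp [pL, ih (piL_mem_chains hv)]

lemma pL_base : pL 𝕜 n (Finsupp.single (base N n) 1) = Finsupp.single (base N n) 1 := by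
  induction n with
  | zero => rfl
  | succ n ih => simp [pL, base, piL_single, ih]

lemma base_admissible : (base N n).Pos ∧ (base N n).deg = 0 ∧ (base N n).wt = N := by
  induction n with
  | zero => simp [base, Pos, deg, wt]
  | succ n ih => simp [base, pos_cons, deg_cons, wt_cons, ih]

lemma bd_eq_zero {x : St n} (h : x.deg = 0) : bd 𝕜 x = 0 := by
  have : ∀ j, (x.2 j).length = 0 := by simpa [deg] using h
  simp [bd, this]

lemma bd_mem_chains {x : St n} (h : x.Pos) (hd : x.deg = p + 1) (hw : x.wt = N) :
    bd 𝕜 x ∈ chains 𝕜 n N p := by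
  induction n generalizing N p with
  | zero => simp [deg] at hd
  | succ n ih =>
    obtain ⟨M, B, y, rfl⟩ := exists_cons x
    rw [pos_cons] at h
    rw [deg_cons] at hd
    rw [wt_cons] at hw
    rw [bd_cons]
    refine add_mem ?_ (Submodule.smul_mem _ _ ?_)
    · unfold bdHead
      split_ifs with hB
      · exact zero_mem _
      · refine sum_mem fun i hi => Submodule.smul_mem _ _ ?_
        obtain ⟨M', B', m', e, h2, h3, h4, -⟩ := exists_mergeAdj_eq B (y.1 0) hB M i h.1
          (Nat.lt_succ_iff.1 (Finset.mem_range.1 hi))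
        have := wt_setHead m' y
        rw [e, glue_eq]
        refine single_mem_chains ((pos_cons ..).2 ⟨h2, (pos_setHead ..).2 h.2⟩) ?_ ?_ 1
        · rw [deg_cons, deg_setHead]; omega
        · rw [wt_cons]; omega
    · rcases hy : y.deg with _ | q
      · rw [bd_eq_zero hy, map_zero]
        exact zero_mem _
      · exact consL_mem_chains h.1 (by omega) hw (ih h.2 hy rfl)

lemma hL_homotopy_of_mem {v : St n →₀ 𝕜} (hv : v ∈ chains 𝕜 n N p) :
    bdL 𝕜 (hL 𝕜 n v) + hL 𝕜 n (bdL 𝕜 v) = v - pL 𝕜 n v := by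
  have := map_mem_of_mem_chains (W := ⊥)
    (f := bdL 𝕜 ∘ₗ hL 𝕜 n + hL 𝕜 n ∘ₗ bdL 𝕜 - (LinearMap.id - pL 𝕜 n))
    (fun x h _ _ => by simp [hL_homotopy 𝕜 x h]) hv
  simpa [sub_eq_zero] using this

variable (𝕜) in
/-- The inclusion of `D(n,N)` in the span of all tuples. -/
noncomputable def incl (n N p : ℕ) : (DBasis n N p →₀ 𝕜) →ₗ[𝕜] (St n →₀ 𝕜) :=
  Finsupp.lmapDomain 𝕜 𝕜 Subtype.val

lemma incl_injective : Function.Injective (incl 𝕜 n N p) :=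
  Finsupp.mapDomain_injective Subtype.val_injective

lemma incl_single (x : DBasis n N p) :
    incl 𝕜 n N p (Finsupp.single x 1) = Finsupp.single x.val 1 :=
  Finsupp.mapDomain_single

lemma incl_mem_chains (z : DBasis n N p →₀ 𝕜) : incl 𝕜 n N p z ∈ chains 𝕜 n N p := by
  induction z using Finsupp.induction_linear with
  | zero => simp
  | add z w hz hw => rw [map_add]; exact add_mem hz hw
  | single x c =>
    rw [← mul_one c, ← smul_eq_mul, ← Finsupp.smul_single, map_smul, incl_single]
    exact Submodule.smul_mem _ _ (single_mem_chains x.2.1 x.2.2.1 x.2.2.2 1)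

lemma exists_incl_eq {v : St n →₀ 𝕜} (hv : v ∈ chains 𝕜 n N p) :
    ∃ z, incl 𝕜 n N p z = v := by
  refine map_mem_of_mem_chains (f := LinearMap.id) (W := LinearMap.range (incl 𝕜 n N p))
    (fun x h1 h2 h3 => ⟨Finsupp.single ⟨x, h1, h2, h3⟩ 1, ?_⟩) hv
  exact incl_single _

lemma incl_linearCombination_deltaD {v : St n →₀ 𝕜} (hv : v ∈ chains 𝕜 n N p) :
    incl 𝕜 n N p (Finsupp.linearCombination 𝕜 (deltaD 𝕜 n N p) v) = v := by
  have := map_mem_of_mem_chains (W := ⊥)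
    (f := incl 𝕜 n N p ∘ₗ Finsupp.linearCombination 𝕜 (deltaD 𝕜 n N p) - LinearMap.id)
    (fun x h1 h2 h3 => by
      have h : deltaD 𝕜 n N p x = Finsupp.single ⟨x, h1, h2, h3⟩ 1 := dif_pos ⟨h1, h2, h3⟩
      have h' := incl_single (𝕜 := 𝕜) (⟨x, h1, h2, h3⟩ : DBasis n N p)
      simp [h, h']) hv
  simpa [sub_eq_zero] using this

lemma diffD_single (x : DBasis n N (p + 1)) :
    diffD 𝕜 n N p (Finsupp.single x 1) =
      Finsupp.linearCombination 𝕜 (deltaD 𝕜 n N p) (bd 𝕜 x.val) := by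
  simp only [diffD, bd, Finsupp.lift_apply, Finsupp.sum_single_index, zero_smul, one_smul, map_sum]
  refine Finset.sum_congr rfl fun j _ => ?_
  split_ifs <;> simp

lemma incl_diffD (z : DBasis n N (p + 1) →₀ 𝕜) :
    incl 𝕜 n N p (diffD 𝕜 n N p z) = bdL 𝕜 (incl 𝕜 n N (p + 1) z) := by
  refine LinearMap.congr_fun (f := incl 𝕜 n N p ∘ₗ diffD 𝕜 n N p)
    (g := bdL 𝕜 ∘ₗ incl 𝕜 n N (p + 1)) (Finsupp.lhom_ext' fun x => LinearMap.ext_ring ?_) z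
  simp only [LinearMap.comp_apply, Finsupp.lsingle_apply, incl_single, bdL_single, diffD_single]
  exact incl_linearCombination_deltaD (bd_mem_chains x.2.1 x.2.2.1 x.2.2.2)

lemma mem_range_diffD_of_homotopy (z : DBasis n N p →₀ 𝕜)
    (hd : bdL 𝕜 (incl 𝕜 n N p z) = 0) (hp : pL 𝕜 n (incl 𝕜 n N p z) = 0) :
    z ∈ LinearMap.range (diffD 𝕜 n N p) := by
  have h := hL_homotopy_of_mem (incl_mem_chains z)
  obtain ⟨w, hw⟩ := exists_incl_eq (hL_mem_chains (incl_mem_chains z))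
  refine ⟨w, incl_injective ?_⟩
  rw [incl_diffD, hw]
  simpa [hd, hp] using h

lemma bdL_incl_zero (z : DBasis n N 0 →₀ 𝕜) : bdL 𝕜 (incl 𝕜 n N 0 z) = 0 :=
  (Submodule.mem_bot 𝕜).1 (map_mem_of_mem_chains
    (fun x _ h _ => by simp [bd_eq_zero h]) (incl_mem_chains z))

variable (𝕜) in
/-- The augmentation of `D(n,N)`. -/
noncomputable def augD (n N : ℕ) : (DBasis n N 0 →₀ 𝕜) →ₗ[𝕜] 𝕜 :=
  Finsupp.lapply (base N n) ∘ₗ pL 𝕜 n ∘ₗ incl 𝕜 n N 0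

lemma augD_surjective : Function.Surjective (augD 𝕜 n N) := by
  refine fun c => ⟨c • Finsupp.single ⟨base N n, base_admissible⟩ 1, ?_⟩
  have h := incl_single (𝕜 := 𝕜) (⟨base N n, base_admissible⟩ : DBasis n N 0)
  simp only [augD, LinearMap.comp_apply, map_smul, h, pL_base]
  simp

lemma ker_augD : LinearMap.ker (augD 𝕜 n N) = LinearMap.range (diffD 𝕜 n N 0) := by
  ext z
  constructor
  · intro hz
    refine mem_range_diffD_of_homotopy z (bdL_incl_zero z) ?_
    obtain ⟨c, hc⟩ := Submodule.mem_span_singleton.1 (pL_mem_span (incl_mem_chains z))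
    have : c = 0 := by simpa [augD, ← hc] using hz
    rw [← hc, this, zero_smul]
  · rintro ⟨w, rfl⟩
    simp [augD, incl_diffD, pL_bdL]

end Chains

/-- **Theorem.** For every field `𝕜` of characteristic `0` and all `n ≥ 1`, `N ≥ 0`,
the complex `D(n,N)` has homology `𝕜` in degree `0` and zero homology in all
degrees `p ≥ 1`. -/
theorem homology_of_DnN (𝕜 : Type) [Field 𝕜] [CharZero 𝕜] (n N : ℕ) (hn : 1 ≤ n) :
    Nonempty ((((DBasis n N 0) →₀ 𝕜) ⧸ LinearMap.range (diffD 𝕜 n N 0)) ≃ₗ[𝕜] 𝕜) ∧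
    (∀ p : ℕ, LinearMap.ker (diffD 𝕜 n N p) ≤ LinearMap.range (diffD 𝕜 n N (p + 1))) := by
  refine ⟨⟨(Submodule.quotEquivOfEq _ _ ker_augD.symm).trans
    ((augD 𝕜 n N).quotKerEquivOfSurjective augD_surjective)⟩, fun p z hz => ?_⟩
  refine mem_range_diffD_of_homotopy z ?_ (pL_eq_zero (incl_mem_chains z))
  rw [← incl_diffD, LinearMap.mem_ker.1 hz, map_zero]

end Paper
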